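/- arXiv:0902.3738 — 2 statements merged into one kernel-verified Lean document; each statement's English description precedes it below -/
import Mathlib

section
/- The operator T_Ω : ω ↦ ∗(Ω ∧ ω) on the 28-dimensional space of alternating 2-forms on ℍ ⊕ ℍ has exactly the two eigenvalues 3 and −1: the set of alternating 2-forms ω such that (Ω ∧ ω ∧ τ)(f₀,…,f₇) = 3⟨ω,τ⟩ for all alternating 2-forms τ is exactly the 7-dimensional linear span of ω₁,…,ω₇, and the set of alternating 2-forms ω such that (Ω ∧ ω ∧ τ)(f₀,…,f₇) = −⟨ω,τ⟩ for all τ is exactly the orthogonal complement of that span, which has dimension 21. -/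
noncomputable section

abbrev H := Quaternion ℝ

def qi : H := ⟨0,1,0,0⟩
def qj : H := ⟨0,0,1,0⟩
def qk : H := ⟨0,0,0,1⟩

def e : Fin 4 → H := ![1, qi, qj, qk]

def f : Fin 8 → H × H := ![(1,0),(qi,0),(qj,0),(qk,0),(0,1),(0,qi),(0,qj),(0,qk)]

def kappa (qp qm q0 : H) (u : H × H) : H × H :=
  (qp * u.1 * star qm, qp * u.2 * star q0)

def IsUnitQ (q : H) : Prop := ‖q‖ = 1

def innerHH (u v : H × H) : ℝ := (u.1 * star v.1).re + (u.2 * star v.2).re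

def Om (u : Fin 4 → H × H) : ℝ :=
  -(1/24) * ∑ σ : Equiv.Perm (Fin 4), ((Equiv.Perm.sign σ : ℤ) : ℝ) *
    ((u (σ 0)).1 * star ((u (σ 1)).1) * (u (σ 2)).1 * star ((u (σ 3)).1)
      - 6 * ((u (σ 0)).1 * star ((u (σ 1)).1) * (u (σ 2)).2 * star ((u (σ 3)).2))
      + (u (σ 0)).2 * star ((u (σ 1)).2) * (u (σ 2)).2 * star ((u (σ 3)).2)).re

def alphaF (u v : H × H) : H :=
  (u.1 * star v.1 - v.1 * star u.1) - (u.2 * star v.2 - v.2 * star u.2)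

def betaF (u v : H × H) : H := star u.1 * v.2 - star v.1 * u.2

def omegaF : Fin 7 → (H × H) → (H × H) → ℝ :=
  ![fun u v => (alphaF u v).imI,
    fun u v => (alphaF u v).imJ,
    fun u v => (alphaF u v).imK,
    fun u v => (betaF u v).re,
    fun u v => (betaF u v).imI,
    fun u v => (betaF u v).imJ,
    fun u v => (betaF u v).imK]

def formInner (a b : (H × H) → (H × H) → ℝ) : ℝ :=
  ∑ p : Fin 8, ∑ q ∈ Finset.Ioi p, a (f p) (f q) * b (f p) (f q)

def IsAlt2 (τ : (H × H) → (H × H) → ℝ) : Prop :=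
  (∀ u, IsLinearMap ℝ (τ u)) ∧ (∀ v, IsLinearMap ℝ fun u => τ u v) ∧ ∀ u, τ u u = 0

def wedge422 (A4 : (Fin 4 → H × H) → ℝ) (a b : (H × H) → (H × H) → ℝ) : ℝ :=
  ∑ σ ∈ Finset.univ.filter (fun σ : Equiv.Perm (Fin 8) =>
      σ 0 < σ 1 ∧ σ 1 < σ 2 ∧ σ 2 < σ 3 ∧ σ 4 < σ 5 ∧ σ 6 < σ 7),
    ((Equiv.Perm.sign σ : ℤ) : ℝ) * A4 ![f (σ 0), f (σ 1), f (σ 2), f (σ 3)]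
      * a (f (σ 4)) (f (σ 5)) * b (f (σ 6)) (f (σ 7))

def coordM (x : Fin 4 → H) : Matrix (Fin 4) (Fin 4) ℝ :=
  Matrix.of fun m => ![(x m).re, (x m).imI, (x m).imJ, (x m).imK]

/-- Entrywise embedding of the integral quaternions into `ℍ`. -/
def castQ (x : Quaternion ℤ) : H := ⟨x.re, x.imI, x.imJ, x.imK⟩

lemma castQ_re (x : Quaternion ℤ) : (castQ x).re = x.re := rfl

lemma castQ_imI (x : Quaternion ℤ) : (castQ x).imI = x.imI := rfl

lemma castQ_imJ (x : Quaternion ℤ) : (castQ x).imJ = x.imJ := rfl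

lemma castQ_imK (x : Quaternion ℤ) : (castQ x).imK = x.imK := rfl

lemma castQ_mul (x y : Quaternion ℤ) : castQ (x * y) = castQ x * castQ y := by
  apply Quaternion.ext <;> simp [castQ_re, castQ_imI, castQ_imJ, castQ_imK]

lemma castQ_star (x : Quaternion ℤ) : castQ (star x) = star (castQ x) := by
  apply Quaternion.ext <;> simp [castQ_re, castQ_imI, castQ_imJ, castQ_imK]

lemma castQ_sub (x y : Quaternion ℤ) : castQ (x - y) = castQ x - castQ y := by
  apply Quaternion.ext <;> simp [castQ_re, castQ_imI, castQ_imJ, castQ_imK]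

/-- The integral coordinates of the basis `f`. -/
def fInt : Fin 8 → Quaternion ℤ × Quaternion ℤ :=
  ![(⟨1, 0, 0, 0⟩, ⟨0, 0, 0, 0⟩), (⟨0, 1, 0, 0⟩, ⟨0, 0, 0, 0⟩), (⟨0, 0, 1, 0⟩, ⟨0, 0, 0, 0⟩),
    (⟨0, 0, 0, 1⟩, ⟨0, 0, 0, 0⟩), (⟨0, 0, 0, 0⟩, ⟨1, 0, 0, 0⟩), (⟨0, 0, 0, 0⟩, ⟨0, 1, 0, 0⟩),
    (⟨0, 0, 0, 0⟩, ⟨0, 0, 1, 0⟩), (⟨0, 0, 0, 0⟩, ⟨0, 0, 0, 1⟩)]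

lemma f_eq_castQ (p : Fin 8) : f p = (castQ (fInt p).1, castQ (fInt p).2) := by
  have h0 : castQ ⟨0, 0, 0, 0⟩ = 0 := by
    apply Quaternion.ext <;> exact Int.cast_zero
  have h1 : castQ ⟨1, 0, 0, 0⟩ = 1 := by
    apply Quaternion.ext
    exacts [Int.cast_one, Int.cast_zero, Int.cast_zero, Int.cast_zero]
  have hi : castQ ⟨0, 1, 0, 0⟩ = qi := by apply Quaternion.ext <;> simp [castQ, qi]
  have hj : castQ ⟨0, 0, 1, 0⟩ = qj := by apply Quaternion.ext <;> simp [castQ, qj]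
  have hk : castQ ⟨0, 0, 0, 1⟩ = qk := by apply Quaternion.ext <;> simp [castQ, qk]
  fin_cases p <;> simp [f, fInt, h0, h1, hi, hj, hk]

/-- The integer `-24 Ω` on basis vectors. -/
def omInt (q : Fin 4 → Fin 8) : ℤ :=
  ∑ σ : Equiv.Perm (Fin 4), (Equiv.Perm.sign σ : ℤ) *
    (((fInt (q (σ 0))).1 * star (fInt (q (σ 1))).1 * (fInt (q (σ 2))).1
        * star (fInt (q (σ 3))).1).re
      - 6 * ((fInt (q (σ 0))).1 * star (fInt (q (σ 1))).1 * (fInt (q (σ 2))).2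
        * star (fInt (q (σ 3))).2).re
      + ((fInt (q (σ 0))).2 * star (fInt (q (σ 1))).2 * (fInt (q (σ 2))).2
        * star (fInt (q (σ 3))).2).re)

lemma Om_comp_f (q : Fin 4 → Fin 8) :
    Om (fun m => f (q m)) = -(1 / 24) * (omInt q : ℝ) := by
  have h6 (x : H) : (6 * x).re = 6 * x.re := by
    rw [show (6 : H) = ((6 : ℝ) : H) from rfl, Quaternion.coe_mul_eq_smul, Quaternion.re_smul,
      smul_eq_mul]
  unfold Om omInt
  push_cast
  congr 1
  refine Finset.sum_congr rfl fun σ _ => ?_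
  simp only [f_eq_castQ, ← castQ_star, ← castQ_mul, Quaternion.re_add, Quaternion.re_sub, h6, castQ_re]

/-- The values of `Ω` on increasing quadruples of basis vectors. -/
def omTable (q : Fin 8 × Fin 8 × Fin 8 × Fin 8) : ℤ :=
  if q ∈ [(0, 1, 2, 3), (0, 2, 5, 7), (1, 3, 4, 6), (4, 5, 6, 7)] then 1
  else if q ∈ [(0, 1, 4, 5), (0, 1, 6, 7), (0, 2, 4, 6), (0, 3, 4, 7), (0, 3, 5, 6),
    (1, 2, 4, 7), (1, 2, 5, 6), (1, 3, 5, 7), (2, 3, 4, 5), (2, 3, 6, 7)] then -1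
  else 0

lemma omInt_eq_omTable (a b c d : Fin 8) (h : a < b ∧ b < c ∧ c < d) :
    omInt ![a, b, c, d] = -24 * omTable (a, b, c, d) := by
  revert a b c d
  decide +kernel

lemma Om_f (a b c d : Fin 8) (h : a < b ∧ b < c ∧ c < d) :
    Om ![f a, f b, f c, f d] = omTable (a, b, c, d) := by
  have hv : ![f a, f b, f c, f d] = fun m => f (![a, b, c, d] m) := by
    funext m
    fin_cases m <;> rfl
  rw [hv, Om_comp_f, omInt_eq_omTable a b c d h]
  push_cast
  ring

/-- The values of `ω₁, …, ω₇` on basis vectors. -/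
def omegaInt (i : Fin 7) (p q : Fin 8) : ℤ :=
  let a := ((fInt p).1 * star (fInt q).1 - (fInt q).1 * star (fInt p).1)
    - ((fInt p).2 * star (fInt q).2 - (fInt q).2 * star (fInt p).2)
  let b := star (fInt p).1 * (fInt q).2 - star (fInt q).1 * (fInt p).2
  ![a.imI, a.imJ, a.imK, b.re, b.imI, b.imJ, b.imK] i

lemma omegaF_f (i : Fin 7) (p q : Fin 8) : omegaF i (f p) (f q) = omegaInt i p q := by
  have ha : alphaF (f p) (f q) = castQ (((fInt p).1 * star (fInt q).1 - (fInt q).1 *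
      star (fInt p).1) - ((fInt p).2 * star (fInt q).2 - (fInt q).2 * star (fInt p).2)) := by
    simp only [alphaF, f_eq_castQ, castQ_star, castQ_mul, castQ_sub]
  have hb : betaF (f p) (f q) = castQ (star (fInt p).1 * (fInt q).2 - star (fInt q).1 *
      (fInt p).2) := by
    simp only [betaF, f_eq_castQ, castQ_star, castQ_mul, castQ_sub]
  fin_cases i <;> simp [omegaF, omegaInt, ha, hb, castQ_re, castQ_imI, castQ_imJ, castQ_imK]

/-- The arrangement of `Fin 8` listing the complement of `{p, q, r, s}` in increasing order,
followed by `p, q, r, s`. -/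
def shuffle (p q r s : Fin 8) (i : Fin 8) : Fin 8 :=
  ((List.finRange 8).filter (fun x => x ≠ p ∧ x ≠ q ∧ x ≠ r ∧ x ≠ s) ++ [p, q, r, s]).getD i 0

lemma shuffle_injective (p q r s : Fin 8) (h : p < q ∧ r < s ∧ p ≠ r ∧ p ≠ s ∧ q ≠ r ∧ q ≠ s) :
    Function.Injective (shuffle p q r s) := by
  revert p q r s
  decide +kernel

lemma shuffle_values (p q r s : Fin 8) (h : p < q ∧ r < s ∧ p ≠ r ∧ p ≠ s ∧ q ≠ r ∧ q ≠ s) :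
    shuffle p q r s 0 < shuffle p q r s 1 ∧ shuffle p q r s 1 < shuffle p q r s 2 ∧
      shuffle p q r s 2 < shuffle p q r s 3 ∧ shuffle p q r s 4 = p ∧ shuffle p q r s 5 = q ∧
      shuffle p q r s 6 = r ∧ shuffle p q r s 7 = s := by
  revert p q r s
  decide +kernel

/-- The sign of an arrangement of `Fin 8`, counted by inversions. -/
def inversionSign (g : Fin 8 → Fin 8) : ℤ :=
  ∏ j, ∏ i ∈ Finset.Iio j, if g i < g j then 1 else -1

/-- The matrix coefficients of `(ω, τ) ↦ Ω ∧ ω ∧ τ`. -/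
def wedgeInt (p q r s : Fin 8) : ℤ :=
  if p ≠ r ∧ p ≠ s ∧ q ≠ r ∧ q ≠ s then
    inversionSign (shuffle p q r s) *
      omTable (shuffle p q r s 0, shuffle p q r s 1, shuffle p q r s 2, shuffle p q r s 3)
  else 0

lemma four_mul_wedgeInt (p q r s : Fin 8) (hpq : p < q) (hrs : r < s) :
    4 * wedgeInt p q r s = -4 * (if p = r ∧ q = s then 1 else 0) +
      ∑ i, ![1, 1, 1, 4, 4, 4, 4] i * (omegaInt i p q * omegaInt i r s) := by
  revert p q r s
  decide +kernel

/-- The pairs `p < q` indexing the coordinates of a 2-form. -/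
abbrev Pairs := {x : Fin 8 × Fin 8 // x.1 < x.2}

lemma formInner_eq_sum_pairs (a b : (H × H) → (H × H) → ℝ) :
    formInner a b = ∑ x : Pairs, a (f x.1.1) (f x.1.2) * b (f x.1.1) (f x.1.2) := by
  rw [← Finset.sum_subtype (Finset.univ.filter fun x : Fin 8 × Fin 8 => x.1 < x.2) (by simp)
    (fun x => a (f x.1) (f x.2) * b (f x.1) (f x.2)), Finset.sum_filter, Fintype.sum_prod_type]
  refine Finset.sum_congr rfl fun p _ => ?_
  rw [← Finset.sum_filter]
  refine Finset.sum_congr ?_ fun _ _ => rfl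
  ext q
  simp

/-- Two pairs with no common element. -/
def DisjointPairs (z : Pairs × Pairs) : Prop :=
  z.1.1.1 ≠ z.2.1.1 ∧ z.1.1.1 ≠ z.2.1.2 ∧ z.1.1.2 ≠ z.2.1.1 ∧ z.1.1.2 ≠ z.2.1.2

instance : DecidablePred DisjointPairs := fun z => by unfold DisjointPairs; infer_instance

/-- The permutation underlying `shuffle`. -/
def shufflePerm (z : Pairs × Pairs) (hz : DisjointPairs z) : Equiv.Perm (Fin 8) :=
  Equiv.ofBijective (shuffle z.1.1.1 z.1.1.2 z.2.1.1 z.2.1.2)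
    (Finite.injective_iff_bijective.1 (shuffle_injective _ _ _ _ ⟨z.1.2, z.2.2, hz⟩))

lemma strictMono_fin_four {g : Fin 4 → Fin 8} (h : g 0 < g 1 ∧ g 1 < g 2 ∧ g 2 < g 3) :
    StrictMono g := by
  rw [Fin.strictMono_iff_lt_succ]
  intro i
  fin_cases i
  exacts [h.1, h.2.1, h.2.2]

/-- A permutation increasing on `0, 1, 2, 3` is determined by its values at `4, 5, 6, 7`. -/
lemma perm_eq_of_increasing {σ τ : Equiv.Perm (Fin 8)}
    (hσ : σ 0 < σ 1 ∧ σ 1 < σ 2 ∧ σ 2 < σ 3) (hτ : τ 0 < τ 1 ∧ τ 1 < τ 2 ∧ τ 2 < τ 3)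
    (h4 : σ 4 = τ 4) (h5 : σ 5 = τ 5) (h6 : σ 6 = τ 6) (h7 : σ 7 = τ 7) : σ = τ := by
  have hr (ρ : Equiv.Perm (Fin 8)) : Set.range (fun i : Fin 4 => ρ (![0, 1, 2, 3] i)) =
      {ρ 4, ρ 5, ρ 6, ρ 7}ᶜ := by
    ext x
    obtain ⟨y, rfl⟩ := ρ.surjective x
    simp only [Set.mem_range, EmbeddingLike.apply_eq_iff_eq, Set.mem_compl_iff,
      Set.mem_insert_iff, Set.mem_singleton_iff]
    revert y
    decide
  have hg : (fun i : Fin 4 => σ (![0, 1, 2, 3] i)) = fun i : Fin 4 => τ (![0, 1, 2, 3] i) := by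
    rw [← StrictMono.range_inj (strictMono_fin_four hσ) (strictMono_fin_four hτ), hr, hr,
      h4, h5, h6, h7]
  ext1 x
  fin_cases x
  exacts [congrFun hg 0, congrFun hg 1, congrFun hg 2, congrFun hg 3, h4, h5, h6, h7]

lemma wedge422_Om_eq_sum (a b : (H × H) → (H × H) → ℝ) :
    wedge422 Om a b = ∑ x : Pairs, ∑ y : Pairs, (wedgeInt x.1.1 x.1.2 y.1.1 y.1.2 : ℝ)
      * (a (f x.1.1) (f x.1.2) * b (f y.1.1) (f y.1.2)) := by
  rw [← Fintype.sum_prod_type' (f := fun x y : Pairs => (wedgeInt x.1.1 x.1.2 y.1.1 y.1.2 : ℝ)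
      * (a (f x.1.1) (f x.1.2) * b (f y.1.1) (f y.1.2))),
    ← Finset.sum_filter_of_ne (p := DisjointPairs)]
  · symm
    unfold wedge422
    refine Finset.sum_bij (fun z hz => shufflePerm z (Finset.mem_filter.1 hz).2) ?_ ?_ ?_ ?_
    · intro z hz
      obtain ⟨h0, h1, h2, h4, h5, h6, h7⟩ :=
        shuffle_values _ _ _ _ ⟨z.1.2, z.2.2, (Finset.mem_filter.1 hz).2⟩
      simp only [Finset.mem_filter, Finset.mem_univ, true_and, shufflePerm,
        Equiv.ofBijective_apply, h4, h5, h6, h7]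
      exact ⟨h0, h1, h2, z.1.2, z.2.2⟩
    · intro z hz w hw h
      obtain ⟨-, -, -, h4, h5, h6, h7⟩ :=
        shuffle_values _ _ _ _ ⟨z.1.2, z.2.2, (Finset.mem_filter.1 hz).2⟩
      obtain ⟨-, -, -, k4, k5, k6, k7⟩ :=
        shuffle_values _ _ _ _ ⟨w.1.2, w.2.2, (Finset.mem_filter.1 hw).2⟩
      have hx (i : Fin 8) : shuffle z.1.1.1 z.1.1.2 z.2.1.1 z.2.1.2 i =
          shuffle w.1.1.1 w.1.1.2 w.2.1.1 w.2.1.2 i := DFunLike.congr_fun h i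
      refine Prod.ext (Subtype.ext (Prod.ext ?_ ?_)) (Subtype.ext (Prod.ext ?_ ?_))
      · rw [← h4, ← k4, hx]
      · rw [← h5, ← k5, hx]
      · rw [← h6, ← k6, hx]
      · rw [← h7, ← k7, hx]
    · intro σ hσ
      obtain ⟨s0, s1, s2, s4, s6⟩ := (Finset.mem_filter.1 hσ).2
      have hz : DisjointPairs (⟨(σ 4, σ 5), s4⟩, ⟨(σ 6, σ 7), s6⟩) := by
        simp [DisjointPairs]
      obtain ⟨h0, h1, h2, h4, h5, h6, h7⟩ := shuffle_values _ _ _ _ ⟨s4, s6, hz⟩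
      exact ⟨_, Finset.mem_filter.2 ⟨Finset.mem_univ _, hz⟩,
        perm_eq_of_increasing ⟨h0, h1, h2⟩ ⟨s0, s1, s2⟩ h4 h5 h6 h7⟩
    · intro z hz
      have hd := (Finset.mem_filter.1 hz).2
      obtain ⟨h0, h1, h2, h4, h5, h6, h7⟩ := shuffle_values _ _ _ _ ⟨z.1.2, z.2.2, hd⟩
      have hs : ((Equiv.Perm.sign (shufflePerm z hd) : ℤ)) =
          inversionSign (shuffle z.1.1.1 z.1.1.2 z.2.1.1 z.2.1.2) := by
        rw [Equiv.Perm.sign_eq_prod_prod_Iio, inversionSign]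
        push_cast
        simp [shufflePerm, apply_ite]
      rw [hs]
      simp only [shufflePerm, Equiv.ofBijective_apply, h4, h5, h6, h7]
      rw [Om_f _ _ _ _ ⟨h0, h1, h2⟩, wedgeInt, if_pos (show _ ∧ _ from hd)]
      push_cast
      ring
  · intro z _ hz
    by_contra hd
    exact hz (by rw [wedgeInt, if_neg (show ¬ (_ ∧ _) from hd)]; simp)

/-- The weights `16 / ‖ω_i‖²`. -/
def weight : Fin 7 → ℤ := ![1, 1, 1, 4, 4, 4, 4]

lemma formInner_omegaF (a : (H × H) → (H × H) → ℝ) (i : Fin 7) :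
    formInner a (omegaF i) =
      ∑ x : Pairs, a (f x.1.1) (f x.1.2) * omegaInt i x.1.1 x.1.2 := by
  simp only [formInner_eq_sum_pairs, omegaF_f]

/-- `T_Ω` equals `-1` plus four times the orthogonal projection onto the span of the `ω_i`. -/
lemma four_mul_wedge422_Om (a b : (H × H) → (H × H) → ℝ) :
    4 * wedge422 Om a b = -4 * formInner a b +
      ∑ i, (weight i : ℝ) * formInner a (omegaF i) * formInner b (omegaF i) := by
  have key (x y : Pairs) : 4 * (wedgeInt x.1.1 x.1.2 y.1.1 y.1.2 : ℝ) =
      -4 * (if x = y then 1 else 0) +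
        ∑ i, (weight i : ℝ) * (omegaInt i x.1.1 x.1.2 * omegaInt i y.1.1 y.1.2) := by
    have h := congrArg (Int.cast (R := ℝ)) (four_mul_wedgeInt _ _ _ _ x.2 y.2)
    push_cast at h
    rw [h]
    simp only [Subtype.ext_iff, Prod.ext_iff, weight]
  rw [wedge422_Om_eq_sum, formInner_eq_sum_pairs]
  simp only [formInner_omegaF, Finset.mul_sum, ← mul_assoc, key, add_mul, Finset.sum_add_distrib]
  congr 1
  · refine Finset.sum_congr rfl fun x _ => ?_
    rw [Finset.sum_eq_single x (by intro y _ hy; simp [hy.symm]) (by simp)]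
    simp
  · simp only [Finset.sum_mul]
    rw [Finset.sum_comm_cycle]
    refine Finset.sum_congr rfl fun i _ => ?_
    rw [Finset.sum_comm]
    refine Finset.sum_congr rfl fun y _ => Finset.sum_congr rfl fun x _ => ?_
    ring

/-- Alternating 2-forms as a submodule of the space of functions. -/
def altForms : Submodule ℝ ((H × H) → (H × H) → ℝ) where
  carrier := {ω | IsAlt2 ω}
  zero_mem' := ⟨fun _ => ⟨by simp, by simp⟩, fun _ => ⟨by simp, by simp⟩, by simp⟩
  add_mem' := by
    rintro a b ⟨ha, ha', ha0⟩ ⟨hb, hb', hb0⟩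
    refine ⟨fun u => ((ha u).mk' _ + (hb u).mk' _).isLinear,
      fun v => ((ha' v).mk' _ + (hb' v).mk' _).isLinear, fun u => ?_⟩
    simp [ha0, hb0]
  smul_mem' := by
    rintro c a ⟨ha, ha', ha0⟩
    refine ⟨fun u => (c • (ha u).mk' _).isLinear, fun v => (c • (ha' v).mk' _).isLinear,
      fun u => ?_⟩
    simp [ha0]

/-- The coordinates of a vector in the basis `f`. -/
def coordF : (H × H) →ₗ[ℝ] (Fin 8 → ℝ) where
  toFun u := ![u.1.re, u.1.imI, u.1.imJ, u.1.imK, u.2.re, u.2.imI, u.2.imJ, u.2.imK]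
  map_add' u v := by ext p; fin_cases p <;> simp
  map_smul' c u := by ext p; fin_cases p <;> simp

lemma coordF_f (p q : Fin 8) : coordF (f p) q = if p = q then 1 else 0 := by
  fin_cases p <;> fin_cases q <;> simp [f_eq_castQ, coordF, fInt, castQ]

lemma sum_coordF_smul_f (u : H × H) : ∑ p, coordF u p • f p = u := by
  refine Prod.ext ?_ ?_ <;> apply Quaternion.ext <;>
    simp [Fin.sum_univ_eight, coordF, f_eq_castQ, fInt] <;> simp [castQ]

lemma IsAlt2.eq_zero {ω : (H × H) → (H × H) → ℝ} (h : IsAlt2 ω)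
    (h0 : ∀ x : Pairs, ω (f x.1.1) (f x.1.2) = 0) : ω = 0 := by
  obtain ⟨h1, h2, h3⟩ := h
  have hanti (u v : H × H) : ω u v = -ω v u := by
    have := h3 (u + v)
    rw [(h1 _).map_add, (h2 _).map_add, (h2 _).map_add, h3, h3] at this
    linarith
  have hf (p q : Fin 8) : ω (f p) (f q) = 0 := by
    rcases lt_trichotomy p q with hpq | rfl | hpq
    · exact h0 ⟨(p, q), hpq⟩
    · exact h3 _
    · rw [hanti, h0 ⟨(q, p), hpq⟩, neg_zero]
  have hr (p : Fin 8) : (h1 (f p)).mk' _ = 0 := by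
    refine LinearMap.ext fun v => ?_
    rw [← sum_coordF_smul_f v]
    simp [hf]
  funext u v
  have hl : (h2 v).mk' _ = 0 := by
    refine LinearMap.ext fun u => ?_
    rw [← sum_coordF_smul_f u]
    have (p : Fin 8) : ω (f p) v = 0 := DFunLike.congr_fun (hr p) v
    simp [this]
  exact DFunLike.congr_fun hl u

/-- The coordinates of an alternating 2-form. -/
def altCoord : altForms →ₗ[ℝ] (Pairs → ℝ) where
  toFun ω x := ω.1 (f x.1.1) (f x.1.2)
  map_add' _ _ := rfl
  map_smul' _ _ := rfl

lemma altCoord_bijective : Function.Bijective altCoord := by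
  constructor
  · rw [← LinearMap.ker_eq_bot, LinearMap.ker_eq_bot']
    exact fun ω h => Subtype.ext (ω.2.eq_zero (congrFun h))
  · intro g
    refine ⟨⟨fun u v => ∑ x : Pairs, g x * (coordF u x.1.1 * coordF v x.1.2
      - coordF u x.1.2 * coordF v x.1.1), ?_, ?_, ?_⟩, ?_⟩
    · refine fun u => ⟨fun v w => ?_, fun c v => ?_⟩
      · rw [← Finset.sum_add_distrib]
        refine Finset.sum_congr rfl fun x _ => ?_
        simp only [map_add, Pi.add_apply]
        ring
      · rw [Finset.smul_sum]
        refine Finset.sum_congr rfl fun x _ => ?_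
        simp only [map_smul, Pi.smul_apply, smul_eq_mul]
        ring
    · refine fun u => ⟨fun v w => ?_, fun c v => ?_⟩
      · rw [← Finset.sum_add_distrib]
        refine Finset.sum_congr rfl fun x _ => ?_
        simp only [map_add, Pi.add_apply]
        ring
      · rw [Finset.smul_sum]
        refine Finset.sum_congr rfl fun x _ => ?_
        simp only [map_smul, Pi.smul_apply, smul_eq_mul]
        ring
    · refine fun u => Finset.sum_eq_zero fun x _ => ?_
      ring
    · funext y
      change ∑ x : Pairs, g x * (coordF (f y.1.1) x.1.1 * coordF (f y.1.2) x.1.2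
        - coordF (f y.1.1) x.1.2 * coordF (f y.1.2) x.1.1) = g y
      simp only [coordF_f]
      rw [Finset.sum_eq_single y]
      · simp [y.2.ne]
      · intro x _ hxy
        have h1 : ¬ (y.1.1 = x.1.1 ∧ y.1.2 = x.1.2) := fun h =>
          hxy (Subtype.ext (Prod.ext h.1.symm h.2.symm))
        have h2 : ¬ (y.1.1 = x.1.2 ∧ y.1.2 = x.1.1) := fun h => by
          have := x.2
          have := y.2
          rw [h.1, h.2] at this
          exact absurd this (not_lt_of_gt x.2)
        simp only [mul_ite, mul_one, mul_zero, ← ite_and]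
        rw [if_neg (by tauto), if_neg (by tauto), sub_zero, mul_zero]
      · simp

lemma finrank_altForms : Module.finrank ℝ altForms = 28 := by
  rw [(LinearEquiv.ofBijective _ altCoord_bijective).finrank_eq, Module.finrank_fintype_fun_eq_card]
  decide

lemma alphaF_add_left (u v w : H × H) : alphaF (u + v) w = alphaF u w + alphaF v w := by
  simp only [alphaF, Prod.fst_add, Prod.snd_add, star_add, mul_add, add_mul]
  abel

lemma alphaF_smul_left (c : ℝ) (u v : H × H) : alphaF (c • u) v = c • alphaF u v := by
  simp only [alphaF, Prod.smul_fst, Prod.smul_snd, Quaternion.star_smul, smul_mul_assoc,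
    mul_smul_comm, smul_sub]

lemma alphaF_swap (u v : H × H) : alphaF u v = -alphaF v u := by
  simp only [alphaF]
  abel

lemma betaF_add_left (u v w : H × H) : betaF (u + v) w = betaF u w + betaF v w := by
  simp only [betaF, Prod.fst_add, Prod.snd_add, star_add, mul_add, add_mul]
  abel

lemma betaF_smul_left (c : ℝ) (u v : H × H) : betaF (c • u) v = c • betaF u v := by
  simp only [betaF, Prod.smul_fst, Prod.smul_snd, Quaternion.star_smul, smul_mul_assoc,
    mul_smul_comm, smul_sub]

lemma betaF_swap (u v : H × H) : betaF u v = -betaF v u := by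
  simp only [betaF]
  abel

lemma isAlt2_of_left {ω : (H × H) → (H × H) → ℝ} (hadd : ∀ u v w, ω (u + v) w = ω u w + ω v w)
    (hsmul : ∀ (c : ℝ) u v, ω (c • u) v = c * ω u v) (hswap : ∀ u v, ω u v = -ω v u) :
    IsAlt2 ω := by
  refine ⟨fun u => ⟨fun v w => ?_, fun c v => ?_⟩, fun u => ⟨fun v w => hadd v w u,
    fun c v => hsmul c v u⟩, fun u => ?_⟩
  · rw [hswap, hadd, hswap v, hswap w]
    ring
  · rw [hswap, hsmul, hswap v, smul_eq_mul]
    ring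
  · linarith [hswap u u]

lemma isAlt2_omegaF (i : Fin 7) : IsAlt2 (omegaF i) := by
  refine isAlt2_of_left (fun u v w => ?_) (fun c u v => ?_) fun u v => ?_
  · fin_cases i <;> simp [omegaF, alphaF_add_left, betaF_add_left]
  · fin_cases i <;> simp [omegaF, alphaF_smul_left, betaF_smul_left]
  · have ha := alphaF_swap u v
    have hb := betaF_swap u v
    fin_cases i <;> simp [omegaF, ha, hb]

lemma formInner_comm (a b : (H × H) → (H × H) → ℝ) : formInner a b = formInner b a := by
  simp only [formInner, mul_comm]

/-- The pairing with a fixed 2-form as a linear functional. -/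
def formInnerLeft (b : (H × H) → (H × H) → ℝ) : ((H × H) → (H × H) → ℝ) →ₗ[ℝ] ℝ where
  toFun a := formInner a b
  map_add' a a' := by simp [formInner, add_mul, Finset.sum_add_distrib]
  map_smul' c a := by simp [formInner, mul_assoc, Finset.mul_sum]

lemma formInnerLeft_apply (a b : (H × H) → (H × H) → ℝ) :
    formInnerLeft b a = formInner a b := rfl

lemma weight_mul_formInner_omegaF (i j : Fin 7) :
    (weight i : ℝ) * formInner (omegaF i) (omegaF j) = if i = j then 16 else 0 := by
  have h : ∀ i j, weight i * ∑ x : Pairs, omegaInt i x.1.1 x.1.2 * omegaInt j x.1.1 x.1.2 =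
      if i = j then 16 else 0 := by
    decide +kernel
  simpa [formInner_omegaF, omegaF_f] using congrArg (Int.cast (R := ℝ)) (h i j)

lemma IsAlt2.eq_zero_of_formInner_self {ω : (H × H) → (H × H) → ℝ} (h : IsAlt2 ω)
    (h0 : formInner ω ω = 0) : ω = 0 := by
  rw [formInner_eq_sum_pairs, Finset.sum_eq_zero_iff_of_nonneg fun x _ => mul_self_nonneg _] at h0
  exact h.eq_zero fun x => mul_self_eq_zero.1 (h0 x (Finset.mem_univ x))

lemma weight_mul_formInner_sum (c : Fin 7 → ℝ) (i : Fin 7) :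
    (weight i : ℝ) * formInner (∑ j, c j • omegaF j) (omegaF i) = 16 * c i := by
  rw [← formInnerLeft_apply, map_sum, Finset.mul_sum, Finset.sum_eq_single i]
  · have h := weight_mul_formInner_omegaF i i
    rw [if_pos rfl] at h
    rw [map_smul, formInnerLeft_apply, smul_eq_mul, mul_left_comm, h, mul_comm]
  · intro j _ hj
    have h := weight_mul_formInner_omegaF i j
    rw [if_neg hj.symm] at h
    rw [map_smul, formInnerLeft_apply, smul_eq_mul, mul_left_comm, formInner_comm, h, mul_zero]
  · simp

lemma formInner_sum_omegaF (c : Fin 7 → ℝ) (τ : (H × H) → (H × H) → ℝ) :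
    formInner (∑ j, c j • omegaF j) τ = ∑ j, c j * formInner τ (omegaF j) := by
  rw [← formInnerLeft_apply, map_sum]
  simp only [map_smul, formInnerLeft_apply, smul_eq_mul, formInner_comm τ]

lemma weight_pos (i : Fin 7) : (0 : ℝ) < weight i := by
  fin_cases i <;> simp [weight]

lemma linearIndependent_omegaF : LinearIndependent ℝ omegaF := by
  rw [Fintype.linearIndependent_iff]
  intro c hc i
  have h := weight_mul_formInner_sum c i
  rw [hc, ← formInnerLeft_apply, map_zero] at h
  linarith

lemma eigenspace_three {ω : (H × H) → (H × H) → ℝ} (hω : IsAlt2 ω) :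
    (∀ τ, IsAlt2 τ → wedge422 Om ω τ = 3 * formInner ω τ) ↔
      ω ∈ Submodule.span ℝ (Set.range omegaF) := by
  constructor
  · intro h
    set ρ := ∑ i, ((weight i : ℝ) * formInner ω (omegaF i) / 16) • omegaF i with hρ
    have hρ_alt : IsAlt2 ρ :=
      altForms.sum_mem fun i _ => altForms.smul_mem _ (isAlt2_omegaF i)
    have hd : IsAlt2 (ω - ρ) := altForms.sub_mem hω hρ_alt
    have h0 : formInner (ω - ρ) (ω - ρ) = 0 := by
      have h1 := four_mul_wedge422_Om ω (ω - ρ)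
      rw [h _ hd] at h1
      nth_rewrite 1 [← formInnerLeft_apply]
      rw [map_sub, formInnerLeft_apply, formInnerLeft_apply, hρ, formInner_sum_omegaF, ← hρ]
      simp only [div_mul_eq_mul_div, ← Finset.sum_div]
      linarith
    rw [sub_eq_zero.1 (hd.eq_zero_of_formInner_self h0)]
    exact Submodule.sum_mem _ fun i _ => Submodule.smul_mem _ _ (Submodule.subset_span ⟨i, rfl⟩)
  · intro h τ _
    obtain ⟨c, rfl⟩ := Submodule.mem_span_range_iff_exists_fun ℝ |>.1 h
    have h1 := four_mul_wedge422_Om (∑ i, c i • omegaF i) τ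
    simp only [weight_mul_formInner_sum, mul_assoc, ← Finset.mul_sum] at h1
    rw [← formInner_sum_omegaF] at h1
    linarith

lemma eigenspace_neg_one {ω : (H × H) → (H × H) → ℝ} (hω : IsAlt2 ω) :
    (∀ τ, IsAlt2 τ → wedge422 Om ω τ = -formInner ω τ) ↔ ∀ i, formInner ω (omegaF i) = 0 := by
  constructor
  · intro h
    have h1 := four_mul_wedge422_Om ω ω
    rw [h _ hω] at h1
    have h2 : ∑ i, (weight i : ℝ) * formInner ω (omegaF i) * formInner ω (omegaF i) = 0 := by
      linarith
    rw [Finset.sum_eq_zero_iff_of_nonneg fun i _ => by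
      rw [mul_assoc]; exact mul_nonneg (weight_pos i).le (mul_self_nonneg _)] at h2
    intro i
    simpa [mul_assoc, (weight_pos i).ne'] using h2 i (Finset.mem_univ i)
  · intro h τ _
    have h1 := four_mul_wedge422_Om ω τ
    simp only [h, mul_zero, zero_mul, Finset.sum_const_zero] at h1
    linarith

/-- The pairings of an alternating 2-form with `ω₁, …, ω₇`. -/
def omegaPairing : altForms →ₗ[ℝ] (Fin 7 → ℝ) :=
  LinearMap.pi fun i => formInnerLeft (omegaF i) ∘ₗ altForms.subtype

lemma omegaPairing_surjective : Function.Surjective omegaPairing := by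
  intro c
  refine ⟨⟨∑ i, ((weight i : ℝ) * c i / 16) • omegaF i,
    altForms.sum_mem fun i _ => altForms.smul_mem _ (isAlt2_omegaF i)⟩, funext fun i => ?_⟩
  have h := weight_mul_formInner_sum (fun i => (weight i : ℝ) * c i / 16) i
  refine mul_left_cancel₀ (weight_pos i).ne' (h.trans ?_)
  ring

lemma finrank_ker_omegaPairing : Module.finrank ℝ (LinearMap.ker omegaPairing) = 21 := by
  have : Module.Finite ℝ altForms := Module.finite_of_finrank_pos (by simp [finrank_altForms])
  have h := omegaPairing.finrank_range_add_finrank_ker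
  rw [LinearMap.range_eq_top.2 omegaPairing_surjective, finrank_top, finrank_altForms,
    Module.finrank_fintype_fun_eq_card, Fintype.card_fin] at h
  omega

/-- the operator T_Ω : ω ↦ ∗(Ω ∧ ω) on the 28-dimensional space of
alternating 2-forms on ℍ ⊕ ℍ has exactly the eigenvalues 3 and −1; the 3-eigenspace is
the 7-dimensional span of ω₁,…,ω₇ and the (−1)-eigenspace is its 21-dimensional
orthogonal complement. -/
theorem stmt9 :
    Module.finrank ℝ ↥(Submodule.span ℝ {ω : (H × H) → (H × H) → ℝ | IsAlt2 ω}) = 28 ∧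
    (∀ ω : (H × H) → (H × H) → ℝ, IsAlt2 ω →
      ((∀ τ : (H × H) → (H × H) → ℝ, IsAlt2 τ →
          wedge422 Om ω τ = 3 * formInner ω τ) ↔
        ω ∈ Submodule.span ℝ (Set.range omegaF))) ∧
    Module.finrank ℝ ↥(Submodule.span ℝ (Set.range omegaF)) = 7 ∧
    (∀ ω : (H × H) → (H × H) → ℝ, IsAlt2 ω →
      ((∀ τ : (H × H) → (H × H) → ℝ, IsAlt2 τ →
          wedge422 Om ω τ = -formInner ω τ) ↔
        ∀ i : Fin 7, formInner ω (omegaF i) = 0)) ∧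
    Module.finrank ℝ ↥(Submodule.span ℝ
      {ω : (H × H) → (H × H) → ℝ | IsAlt2 ω ∧ ∀ i : Fin 7, formInner ω (omegaF i) = 0}) = 21 := by
  refine ⟨?_, fun ω hω => eigenspace_three hω, ?_, fun ω hω => eigenspace_neg_one hω, ?_⟩
  · exact (congrArg (fun S : Submodule ℝ _ => Module.finrank ℝ S)
      (Submodule.span_eq altForms)).trans finrank_altForms
  · simpa using finrank_span_eq_card linearIndependent_omegaF
  · have hS : {ω : (H × H) → (H × H) → ℝ | IsAlt2 ω ∧ ∀ i : Fin 7, formInner ω (omegaF i) = 0} =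
        (LinearMap.ker omegaPairing).map altForms.subtype := by
      ext ω
      constructor
      · exact fun h => ⟨⟨ω, h.1⟩, funext h.2, rfl⟩
      · rintro ⟨ρ, hρ, rfl⟩
        exact ⟨ρ.2, congrFun hρ⟩
    rw [hS, Submodule.span_eq, Submodule.finrank_map_subtype_eq, finrank_ker_omegaPairing]
end
end

section
/- The Cayley form Ω has comass one: for every quadruple (u₁, u₂, u₃, u₄) of vectors in ℍ ⊕ ℍ that is orthonormal with respect to the standard Euclidean inner product ⟨(x,y),(x',y')⟩ = Re(x x̄') + Re(y ȳ'), one has |Ω(u₁, u₂, u₃, u₄)| ≤ 1; moreover the value 1 is attained, e.g. Ω((1,0),(i,0),(j,0),(k,0)) = 1. -/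
noncomputable section

theorem sum_perm_fin_four (g : Fin 4 → Fin 4 → Fin 4 → Fin 4 → ℝ) :
    ∑ σ : Equiv.Perm (Fin 4), ((Equiv.Perm.sign σ : ℤ) : ℝ) * g (σ 0) (σ 1) (σ 2) (σ 3) =
      (g 0 1 2 3 - g 0 1 3 2 - g 0 2 1 3 + g 0 2 3 1 + g 0 3 1 2 - g 0 3 2 1)
      - (g 1 0 2 3 - g 1 0 3 2 - g 1 2 0 3 + g 1 2 3 0 + g 1 3 0 2 - g 1 3 2 0)
      + (g 2 0 1 3 - g 2 0 3 1 - g 2 1 0 3 + g 2 1 3 0 + g 2 3 0 1 - g 2 3 1 0)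
      - (g 3 0 1 2 - g 3 0 2 1 - g 3 1 0 2 + g 3 1 2 0 + g 3 2 0 1 - g 3 2 1 0) := by
  have h4 (p : Fin 4) (τ : Equiv.Perm (Fin 3)) :
      Equiv.Perm.decomposeFin.symm (p, τ) 2 = Equiv.swap 0 p (τ 1).succ ∧
      Equiv.Perm.decomposeFin.symm (p, τ) 3 = Equiv.swap 0 p (τ 2).succ :=
    ⟨Equiv.Perm.decomposeFin_symm_apply_succ τ p 1, Equiv.Perm.decomposeFin_symm_apply_succ τ p 2⟩
  have h3 (p : Fin 3) (τ : Equiv.Perm (Fin 2)) :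
      Equiv.Perm.decomposeFin.symm (p, τ) 2 = Equiv.swap 0 p (τ 1).succ :=
    Equiv.Perm.decomposeFin_symm_apply_succ τ p 1
  have h1 : (1 : Fin 3).succ = (2 : Fin 4) := rfl
  have h2 : (2 : Fin 3).succ = (3 : Fin 4) := rfl
  simp [Finset.univ_perm_fin_succ, Finset.sum_product, Fin.sum_univ_succ,
    Equiv.Perm.decomposeFin.symm_sign, Equiv.Perm.decomposeFin_symm_apply_zero,
    Equiv.swap_apply_def, ← Finset.univ_product_univ, Finset.sum_map, h1, h2, h3, h4]
  ring

/-- The octonion product `v̄ u` on `ℍ ⊕ ℍ`, in a Cayley–Dickson convention adapted to `Om`. -/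
def octMul (u v : H × H) : H × H :=
  (u.1 * star v.1 + v.2 * star u.2, star u.1 * v.2 - star v.1 * u.2)

theorem innerHH_octMul_self (u v : H × H) :
    innerHH (octMul u v) (octMul u v) = innerHH u u * innerHH v v := by
  simp [innerHH, octMul]
  ring

theorem innerHH_eq (u v : H × H) :
    innerHH u v = u.1.re * v.1.re + u.1.imI * v.1.imI + u.1.imJ * v.1.imJ + u.1.imK * v.1.imK
      + u.2.re * v.2.re + u.2.imI * v.2.imI + u.2.imJ * v.2.imJ + u.2.imK * v.2.imK := by
  simp [innerHH]
  ring

theorem innerHH_sq_le (u v : H × H) : innerHH u v ^ 2 ≤ innerHH u u * innerHH v v := by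
  have h := Finset.sum_mul_sq_le_sq_mul_sq Finset.univ
    ![u.1.re, u.1.imI, u.1.imJ, u.1.imK, u.2.re, u.2.imI, u.2.imJ, u.2.imK]
    ![v.1.re, v.1.imI, v.1.imJ, v.1.imK, v.2.re, v.2.imI, v.2.imJ, v.2.imK]
  simp [Fin.sum_univ_succ] at h
  rw [innerHH_eq, innerHH_eq, innerHH_eq]
  linarith

theorem re_mul_star_mul_mul_star (a b c d : H) :
    (a * star b * c * star d).re = (a * star b).re * (c * star d).re
      - (a * star b).imI * (c * star d).imI - (a * star b).imJ * (c * star d).imJ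
      - (a * star b).imK * (c * star d).imK := by
  rw [mul_assoc, Quaternion.re_mul]

theorem re_six_mul (a : H) : (6 * a).re = 6 * a.re := by
  rw [show (6 : H) = ((6 : ℝ) : H) by norm_cast, Quaternion.coe_mul_eq_smul]
  rfl

theorem innerHH_octMul_octMul (u : Fin 4 → H × H) :
    innerHH (octMul (u 0) (u 1)) (octMul (u 2) (u 3)) =
      Om u + innerHH (u 0) (u 1) * innerHH (u 2) (u 3)
        + innerHH (u 0) (u 2) * innerHH (u 1) (u 3)
        - innerHH (u 0) (u 3) * innerHH (u 1) (u 2) := by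
  have h := sum_perm_fin_four fun a b c d =>
    ((u a).1 * star ((u b).1) * (u c).1 * star ((u d).1)
      - 6 * ((u a).1 * star ((u b).1) * (u c).2 * star ((u d).2))
      + (u a).2 * star ((u b).2) * (u c).2 * star ((u d).2)).re
  beta_reduce at h
  rw [Om, h]
  simp only [Quaternion.re_add, Quaternion.re_sub, re_six_mul, re_mul_star_mul_mul_star, innerHH_eq]
  generalize u 0 = a, u 1 = b, u 2 = c, u 3 = d
  simp only [octMul, Quaternion.re_mul, Quaternion.imI_mul,
    Quaternion.imJ_mul, Quaternion.imK_mul, Quaternion.re_star, Quaternion.imI_star,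
    Quaternion.imJ_star, Quaternion.imK_star, Quaternion.re_add, Quaternion.re_sub,
    Quaternion.imI_add, Quaternion.imI_sub, Quaternion.imJ_add, Quaternion.imJ_sub,
    Quaternion.imK_add, Quaternion.imK_sub]
  ring

/-- the Cayley form Ω has comass one: |Ω(u₁,u₂,u₃,u₄)| ≤ 1 on every
orthonormal quadruple, and the value 1 is attained on ((1,0),(i,0),(j,0),(k,0)). -/
theorem stmt15 :
    (∀ u : Fin 4 → H × H,
      (∀ m m' : Fin 4, innerHH (u m) (u m') = if m = m' then 1 else 0) →
      |Om u| ≤ 1) ∧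
    Om ![(1,0),(qi,0),(qj,0),(qk,0)] = 1 := by
  refine ⟨fun u hu => ?_, ?_⟩
  · have h := innerHH_sq_le (octMul (u 0) (u 1)) (octMul (u 2) (u 3))
    rw [innerHH_octMul_self, innerHH_octMul_self, innerHH_octMul_octMul] at h
    simp only [hu] at h
    rw [← sq_le_one_iff_abs_le_one]
    simpa using h
  · have h := innerHH_octMul_octMul ![(1,0),(qi,0),(qj,0),(qk,0)]
    have h0 : (0 : H).re = 0 ∧ (0 : H).imI = 0 ∧ (0 : H).imJ = 0 ∧ (0 : H).imK = 0 :=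
      ⟨rfl, rfl, rfl, rfl⟩
    have h1 : (1 : H).re = 1 ∧ (1 : H).imI = 0 ∧ (1 : H).imJ = 0 ∧ (1 : H).imK = 0 :=
      ⟨rfl, rfl, rfl, rfl⟩
    have hi : qi.re = 0 ∧ qi.imI = 1 ∧ qi.imJ = 0 ∧ qi.imK = 0 := ⟨rfl, rfl, rfl, rfl⟩
    have hj : qj.re = 0 ∧ qj.imI = 0 ∧ qj.imJ = 1 ∧ qj.imK = 0 := ⟨rfl, rfl, rfl, rfl⟩
    have hk : qk.re = 0 ∧ qk.imI = 0 ∧ qk.imJ = 0 ∧ qk.imK = 1 := ⟨rfl, rfl, rfl, rfl⟩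
    simp [innerHH_eq, octMul, h0, h1, hi, hj, hk] at h
    linarith
end
end
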